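/- Let k ∈ ℕ_0 and let S_a be a non-singular subdivision scheme with dilation mI, |m| ≥ 2, with symbol a(z) and parameter values t^{(r)}_α = α/m^r − τ Σ_{i=1}^r m^{−i} for some τ ∈ ℝ^s. Then S_a reproduces polynomials of total degree up to k if and only if (D^j a)(1,…,1) = |m|^s q_j(τ) and (D^j a)(ε) = 0 for every ε ∈ Ξ′ and every multi-index j ∈ ℕ_0^s with |j| ≤ k. -/

import Mathlib

open Finset Filter

noncomputable section

/-- Sequences indexed by `ℤ^s`. -/
abbrev ZS (s : ℕ) := Fin s → ℤ

/-- `z^α = z_1^{α_1} ⋯ z_s^{α_s}` for `z ∈ ℂ^s`, `α ∈ ℤ^s`. -/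
def zpowV {s : ℕ} (z : Fin s → ℂ) (α : Fin s → ℤ) : ℂ := ∏ i, z i ^ α i

/-- The tensor-product falling factorial polynomial
`q_j(x) = ∏_i ∏_{ℓ=0}^{j_i-1} (x_i - ℓ)` (complex version). -/
def qpolyC {s : ℕ} (j : Fin s → ℕ) (x : Fin s → ℂ) : ℂ :=
  ∏ i, ∏ l ∈ Finset.range (j i), (x i - l)

/-- The tensor-product falling factorial polynomial (real version). -/
def qpolyR {s : ℕ} (j : Fin s → ℕ) (x : Fin s → ℝ) : ℝ :=
  ∏ i, ∏ l ∈ Finset.range (j i), (x i - l)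

/-- `(D^j a)(z) = ∑_α q_j(α) a_α z^{α-j}`, the `j`-th iterated partial derivative of the symbol
`a(z) = ∑_α a_α z^α`.  For `j = 0` this is the symbol itself. -/
def symbolD {s : ℕ} (a : ZS s → ℝ) (j : Fin s → ℕ) (z : Fin s → ℂ) : ℂ :=
  ∑ᶠ α : ZS s, qpolyC j (fun i => (α i : ℂ)) * (a α : ℂ) * zpowV z (fun i => α i - (j i : ℤ))

/-- The point `(1,…,1) ∈ ℂ^s`. -/
def onesC {s : ℕ} : Fin s → ℂ := fun _ => 1

/-- `e ∈ E = {0,…,|m|-1}^s`. -/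
def inE {s : ℕ} (m : ℤ) (e : ZS s) : Prop := ∀ i, 0 ≤ e i ∧ e i < |m|

/-- `ε_e = (e^{-2πi e_1/m}, …, e^{-2πi e_s/m}) ∈ ℂ^s`. -/
def epsPt {s : ℕ} (m : ℤ) (e : ZS s) : Fin s → ℂ :=
  fun i => Complex.exp (-(2 * Real.pi * Complex.I * e i) / m)

/-- The subdivision operator `(S_a d)_α = ∑_β a_{α-mβ} d_β`. -/
def subdOp {s : ℕ} (m : ℤ) (a : ZS s → ℝ) (d : ZS s → ℝ) : ZS s → ℝ :=
  fun α => ∑ᶠ β : ZS s, a (α - m • β) * d β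

/-- The parameter values `t^{(r)}_α = α/m^r - τ ∑_{i=1}^r m^{-i}` attached to the data at
level `r`. -/
def param {s : ℕ} (m : ℤ) (τ : Fin s → ℝ) (r : ℕ) (α : ZS s) : Fin s → ℝ :=
  fun i => (α i : ℝ) / (m : ℝ) ^ r - τ i * ∑ n ∈ Finset.range r, ((m : ℝ) ^ (n + 1))⁻¹

/-- The subdivision scheme `S_a` (with dilation `mI` and parametrization offset `τ`) converges
from initial data `d` to the limit `g`: there are continuous functions `F^{(r)}` interpolating
the data `S_a^r d` at the parameter values `t^{(r)}`, converging uniformly to `g`. -/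
def ConvergesTo {s : ℕ} (m : ℤ) (a : ZS s → ℝ) (τ : Fin s → ℝ)
    (d : ZS s → ℝ) (g : (Fin s → ℝ) → ℝ) : Prop :=
  ∃ F : ℕ → (Fin s → ℝ) → ℝ,
    (∀ r, Continuous (F r)) ∧
    (∀ r α, F r (param m τ r α) = (subdOp m a)^[r] d α) ∧
    TendstoUniformly F g atTop

/-- Bounded data. -/
def Bdd {s : ℕ} (d : ZS s → ℝ) : Prop := ∃ C, ∀ α, |d α| ≤ C

/-- The subdivision scheme is convergent: every bounded initial data admits a limit. -/
def Convergent {s : ℕ} (m : ℤ) (a : ZS s → ℝ) (τ : Fin s → ℝ) : Prop :=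
  ∀ d, Bdd d → ∃ g, ConvergesTo m a τ d g

/-- The subdivision scheme is non-singular: it is convergent and a zero limit forces zero data. -/
def NonSingular {s : ℕ} (m : ℤ) (a : ZS s → ℝ) (τ : Fin s → ℝ) : Prop :=
  Convergent m a τ ∧
  ∀ d, Bdd d → ∀ g, ConvergesTo m a τ d g → g = 0 → (∀ α, d α = 0)

/-- `S_a` reproduces polynomials up to degree `k`: for every `s`-variate real polynomial `π` of
total degree at most `k`, the scheme converges from the data `(π(α))_α` to the limit `π`. -/
def Reproduces {s : ℕ} (m : ℤ) (a : ZS s → ℝ) (τ : Fin s → ℝ) (k : ℕ) : Prop :=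
  ∀ π : MvPolynomial (Fin s) ℝ, π.totalDegree ≤ k →
    ConvergesTo m a τ (fun α => MvPolynomial.eval (fun i => (α i : ℝ)) π)
      (fun x => MvPolynomial.eval x π)

/-- `S_a` is step-wise polynomial reproducing up to degree `k`:
`S_a (π(t^{(r)}_·)) = π(t^{(r+1)}_·)` for every polynomial `π` of total degree at most `k`. -/
def StepwiseReproduces {s : ℕ} (m : ℤ) (a : ZS s → ℝ) (τ : Fin s → ℝ) (k : ℕ) : Prop :=
  ∀ π : MvPolynomial (Fin s) ℝ, π.totalDegree ≤ k → ∀ r : ℕ, ∀ α : ZS s,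
    subdOp m a (fun β => MvPolynomial.eval (param m τ r β) π) α
      = MvPolynomial.eval (param m τ (r + 1) α) π

/-- Condition `Z_k`: `a(1,…,1) = |m|^s` and `(D^j a)(ε) = 0` for all `ε ∈ Ξ'` and `|j| < k`. -/
def CondZ {s : ℕ} (m : ℤ) (a : ZS s → ℝ) (k : ℕ) : Prop :=
  symbolD a 0 onesC = ((|m| : ℤ) : ℂ) ^ s ∧
  ∀ e : ZS s, inE m e → e ≠ 0 → ∀ j : Fin s → ℕ, (∑ i, j i) < k →
    symbolD a j (epsPt m e) = 0

/-! ### Affine substitutions and falling factorials in `MvPolynomial` -/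

/-- The affine substitution `π(x) ↦ π(c x + b)`. -/
def affineSubst {s : ℕ} (c : ℝ) (b : Fin s → ℝ) (π : MvPolynomial (Fin s) ℝ) :
    MvPolynomial (Fin s) ℝ :=
  MvPolynomial.aeval (fun i => MvPolynomial.C c * MvPolynomial.X i + MvPolynomial.C (b i)) π

lemma eval_affineSubst {s : ℕ} (c : ℝ) (b x : Fin s → ℝ) (π : MvPolynomial (Fin s) ℝ) :
    MvPolynomial.eval x (affineSubst c b π) = MvPolynomial.eval (fun i => c * x i + b i) π := by
  unfold affineSubst
  induction π using MvPolynomial.induction_on with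
  | C r => simp
  | add p q hp hq => rw [map_add, map_add, map_add, hp, hq]
  | mul_X p i hp => rw [map_mul, map_mul, map_mul, hp]; simp

lemma totalDegree_affineSubst_le {s : ℕ} (c : ℝ) (b : Fin s → ℝ) (π : MvPolynomial (Fin s) ℝ) :
    (affineSubst c b π).totalDegree ≤ π.totalDegree := by
  have hlin : ∀ i, (MvPolynomial.C c * MvPolynomial.X i + MvPolynomial.C (b i) :
      MvPolynomial (Fin s) ℝ).totalDegree ≤ 1 := fun i => by
    refine (MvPolynomial.totalDegree_add _ _).trans (max_le ?_ (by simp))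
    refine (MvPolynomial.totalDegree_mul _ _).trans ?_
    simp
  unfold affineSubst
  conv_lhs => rw [π.as_sum, map_sum]
  refine MvPolynomial.totalDegree_finsetSum_le fun d hd => ?_
  rw [MvPolynomial.aeval_monomial]
  refine (MvPolynomial.totalDegree_mul _ _).trans ?_
  have h0 : (algebraMap ℝ (MvPolynomial (Fin s) ℝ) (MvPolynomial.coeff d π)).totalDegree = 0 :=
    MvPolynomial.totalDegree_C _
  rw [h0, zero_add]
  refine le_trans ?_ (MvPolynomial.le_totalDegree hd)
  refine (MvPolynomial.totalDegree_finsetProd _ _).trans (Finset.sum_le_sum fun i _ => ?_)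
  refine (MvPolynomial.totalDegree_pow _ _).trans ?_
  simpa using Nat.mul_le_mul_left (d i) (hlin i)

/-- The falling factorial `q_j` as a polynomial. -/
def fallingPoly {s : ℕ} (j : Fin s → ℕ) : MvPolynomial (Fin s) ℝ :=
  ∏ i, ∏ l ∈ Finset.range (j i), (MvPolynomial.X i - MvPolynomial.C (l : ℝ))

lemma eval_fallingPoly {s : ℕ} (j : Fin s → ℕ) (x : Fin s → ℝ) :
    MvPolynomial.eval x (fallingPoly j) = qpolyR j x := by
  simp [fallingPoly, qpolyR, map_prod]

lemma totalDegree_fallingPoly_le {s : ℕ} (j : Fin s → ℕ) :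
    (fallingPoly j).totalDegree ≤ ∑ i, j i := by
  refine (MvPolynomial.totalDegree_finsetProd _ _).trans (Finset.sum_le_sum fun i _ => ?_)
  refine (MvPolynomial.totalDegree_finsetProd _ _).trans ?_
  refine (Finset.sum_le_card_nsmul _ _ 1 fun l _ => ?_).trans (by simp)
  exact (MvPolynomial.totalDegree_sub_C_le _ _).trans (by simp)

lemma fallingPoly_add_single {s : ℕ} (j : Fin s → ℕ) (i : Fin s) :
    fallingPoly (j + Pi.single i 1) =
      fallingPoly j * (MvPolynomial.X i - MvPolynomial.C (j i : ℝ)) := by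
  unfold fallingPoly
  rw [← Finset.mul_prod_erase _ _ (Finset.mem_univ i),
    ← Finset.mul_prod_erase univ (fun i' => ∏ l ∈ Finset.range (j i'), _) (Finset.mem_univ i)]
  have : ∏ x ∈ univ.erase i, ∏ l ∈ Finset.range ((j + Pi.single i 1 : Fin s → ℕ) x),
      (MvPolynomial.X x - MvPolynomial.C (l : ℝ) : MvPolynomial (Fin s) ℝ) =
      ∏ x ∈ univ.erase i, ∏ l ∈ Finset.range (j x),
      (MvPolynomial.X x - MvPolynomial.C (l : ℝ)) := by
    refine Finset.prod_congr rfl fun x hx => ?_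
    simp [Pi.single_eq_of_ne (Finset.ne_of_mem_erase hx)]
  rw [this]
  simp only [Pi.add_apply, Pi.single_eq_same, Finset.prod_range_succ]
  ring

/-- The span of the falling factorials `q_j` with `|j| ≤ n`. -/
def fallingSpan (s n : ℕ) : Submodule ℝ (MvPolynomial (Fin s) ℝ) :=
  Submodule.span ℝ (fallingPoly '' {j : Fin s → ℕ | ∑ i, j i ≤ n})

lemma fallingSpan_mono {s : ℕ} {n n' : ℕ} (h : n ≤ n') : fallingSpan s n ≤ fallingSpan s n' :=
  Submodule.span_mono (Set.image_mono fun _ hj => le_trans hj h)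

lemma mul_X_mem_fallingSpan {s n : ℕ} {p : MvPolynomial (Fin s) ℝ} (hp : p ∈ fallingSpan s n)
    (i : Fin s) : p * MvPolynomial.X i ∈ fallingSpan s (n + 1) := by
  refine Submodule.span_induction (p := fun p _ => p * MvPolynomial.X i ∈ fallingSpan s (n + 1))
    ?_ (by simp) (fun x y _ _ hx hy => by rw [add_mul]; exact add_mem hx hy)
    (fun r x _ hx => by rw [smul_mul_assoc]; exact Submodule.smul_mem _ _ hx) hp
  rintro _ ⟨j, hj, rfl⟩
  have h1 : fallingPoly j * MvPolynomial.X i =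
      fallingPoly (j + Pi.single i 1) + (j i : ℝ) • fallingPoly j := by
    rw [fallingPoly_add_single, MvPolynomial.smul_eq_C_mul]; ring
  rw [h1]
  refine add_mem (Submodule.subset_span ⟨_, ?_, rfl⟩)
    (Submodule.smul_mem _ _ (Submodule.subset_span ⟨_, Nat.le_succ_of_le hj, rfl⟩))
  simpa [Finset.sum_add_distrib] using hj

lemma monomial_mem_fallingSpan {s : ℕ} (n : ℕ) (d : Fin s →₀ ℕ) (hd : d.sum (fun _ e => e) ≤ n) :
    MvPolynomial.monomial d (1 : ℝ) ∈ fallingSpan s n := by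
  induction n generalizing d with
  | zero =>
    have : d = 0 := by
      ext i
      by_contra h
      have : i ∈ d.support := by simpa using h
      have := Finset.single_le_sum (f := d) (fun _ _ => Nat.zero_le _) this
      change ∑ i ∈ d.support, d i ≤ 0 at hd
      simp only [Finsupp.coe_zero, Pi.zero_apply] at h
      omega
    subst this
    refine Submodule.subset_span ⟨0, by simp, ?_⟩
    simp [fallingPoly, MvPolynomial.monomial_zero']
  | succ n ih =>
    by_cases h0 : d = 0
    · subst h0
      exact fallingSpan_mono n.le_succ (ih 0 (by simp))
    · obtain ⟨i, hi⟩ := Finsupp.ne_iff.1 h0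
      simp only [Finsupp.coe_zero, Pi.zero_apply] at hi
      have hsplit : d = (d - Finsupp.single i 1) + Finsupp.single i 1 :=
        (tsub_add_cancel_of_le (by simpa using Nat.one_le_iff_ne_zero.2 hi)).symm
      rw [hsplit, MvPolynomial.monomial_add_single, pow_one]
      refine mul_X_mem_fallingSpan (ih _ ?_) i
      rw [hsplit, Finsupp.sum_add_index' (by simp) (by simp)] at hd
      simpa using hd

lemma mem_fallingSpan {s n : ℕ} {π : MvPolynomial (Fin s) ℝ} (hπ : π.totalDegree ≤ n) :
    π ∈ fallingSpan s n := by
  rw [π.as_sum]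
  refine sum_mem fun d hd => ?_
  have : MvPolynomial.monomial d (MvPolynomial.coeff d π) =
      MvPolynomial.coeff d π • MvPolynomial.monomial d (1 : ℝ) := by
    simp [MvPolynomial.smul_monomial]
  rw [this]
  exact Submodule.smul_mem _ _
    (monomial_mem_fallingSpan n d ((MvPolynomial.le_totalDegree hd).trans hπ))

/-- A linear identity valid for all `q_j`, `|j| ≤ n`, holds for all polynomials of degree `≤ n`. -/
lemma linear_eq_of_fallingPoly {s n : ℕ} (f g : MvPolynomial (Fin s) ℝ →ₗ[ℝ] ℝ)
    (h : ∀ j : Fin s → ℕ, ∑ i, j i ≤ n → f (fallingPoly j) = g (fallingPoly j))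
    {π : MvPolynomial (Fin s) ℝ} (hπ : π.totalDegree ≤ n) : f π = g π := by
  refine LinearMap.eqOn_span (s := fallingPoly '' {j : Fin s → ℕ | ∑ i, j i ≤ n}) ?_
    (mem_fallingSpan hπ)
  rintro _ ⟨j, hj, rfl⟩
  exact h j hj

lemma qpolyR_eq_mul_prod_erase {s : ℕ} (i : Fin s) (j : Fin s → ℕ) (x : Fin s → ℝ) :
    qpolyR j x = (∏ l ∈ Finset.range (j i), (x i - (l : ℝ))) *
      ∏ y ∈ univ.erase i, ∏ l ∈ Finset.range (j y), (x y - (l : ℝ)) :=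
  (Finset.mul_prod_erase _ _ (Finset.mem_univ i)).symm

lemma qpolyR_shift_add_single {s : ℕ} (j : Fin s → ℕ) (i : Fin s) (x : Fin s → ℝ) :
    qpolyR (j + Pi.single i 1) (x + Pi.single i 1) =
      qpolyR (j + Pi.single i 1) x + (j i + 1) * qpolyR j x := by
  rw [qpolyR_eq_mul_prod_erase i, qpolyR_eq_mul_prod_erase i _ x,
    qpolyR_eq_mul_prod_erase i j x]
  have h1 : ∏ y ∈ univ.erase i, ∏ l ∈ Finset.range ((j + Pi.single i 1 : Fin s → ℕ) y),
      ((x + Pi.single i 1 : Fin s → ℝ) y - (l : ℝ)) =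
      ∏ y ∈ univ.erase i, ∏ l ∈ Finset.range (j y), (x y - (l : ℝ)) := by
    refine Finset.prod_congr rfl fun y hy => ?_
    simp [Pi.single_eq_of_ne (Finset.ne_of_mem_erase hy)]
  have h2 : ∏ y ∈ univ.erase i, ∏ l ∈ Finset.range ((j + Pi.single i 1 : Fin s → ℕ) y), (x y - (l : ℝ)) =
      ∏ y ∈ univ.erase i, ∏ l ∈ Finset.range (j y), (x y - (l : ℝ)) := by
    refine Finset.prod_congr rfl fun y hy => ?_
    simp [Pi.single_eq_of_ne (Finset.ne_of_mem_erase hy)]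
  rw [h1, h2]
  simp only [Pi.add_apply, Pi.single_eq_same]
  rw [Finset.prod_range_succ', Finset.prod_range_succ (fun l : ℕ => x i - (l : ℝ))]
  have h3 : ∏ k ∈ Finset.range (j i), (x i + 1 - ((k + 1 : ℕ) : ℝ)) =
      ∏ k ∈ Finset.range (j i), (x i - (k : ℝ)) :=
    Finset.prod_congr rfl fun k _ => by push_cast; ring
  rw [h3]
  push_cast
  ring

lemma qpolyR_shift_of_eq_zero {s : ℕ} (j : Fin s → ℕ) (i : Fin s) (hj : j i = 0)
    (x : Fin s → ℝ) : qpolyR j (x + Pi.single i 1) = qpolyR j x := by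
  refine Finset.prod_congr rfl fun y _ => ?_
  by_cases h : y = i
  · subst h; simp [hj]
  · simp [Pi.single_eq_of_ne h]

/-! ### Orthogonality of the characters `γ ↦ ε_e^γ` -/

/-- The index set `E = {0,…,|m|-1}^s` as a finset. -/
def digitBox (s : ℕ) (m : ℤ) : Finset (ZS s) := Fintype.piFinset fun _ => Finset.Ico 0 |m|

lemma mem_digitBox {s : ℕ} {m : ℤ} {e : ZS s} : e ∈ digitBox s m ↔ inE m e := by
  simp [digitBox, inE]

lemma zpowV_add {s : ℕ} {z : Fin s → ℂ} (hz : ∀ i, z i ≠ 0) (α β : ZS s) :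
    zpowV z (α + β) = zpowV z α * zpowV z β := by
  simp only [zpowV, ← Finset.prod_mul_distrib]
  exact Finset.prod_congr rfl fun i _ => zpow_add₀ (hz i) _ _

lemma zpowV_ne_zero {s : ℕ} {z : Fin s → ℂ} (hz : ∀ i, z i ≠ 0) (α : ZS s) : zpowV z α ≠ 0 :=
  Finset.prod_ne_zero_iff.2 fun i _ => zpow_ne_zero _ (hz i)

lemma epsPt_ne_zero {s : ℕ} (m : ℤ) (e : ZS s) (i : Fin s) : epsPt m e i ≠ 0 :=
  Complex.exp_ne_zero _

lemma epsPt_zero {s : ℕ} (m : ℤ) : epsPt m (0 : ZS s) = onesC := by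
  funext i; simp [epsPt, onesC]

lemma epsPt_zpow_comm {s : ℕ} (m : ℤ) (e γ : ZS s) (i : Fin s) :
    epsPt m e i ^ γ i = epsPt m γ i ^ e i := by
  simp only [epsPt, ← Complex.exp_int_mul]
  congr 1
  ring

lemma zpowV_epsPt_comm {s : ℕ} (m : ℤ) (e γ : ZS s) :
    zpowV (epsPt m e) γ = zpowV (epsPt m γ) e :=
  Finset.prod_congr rfl fun i _ => epsPt_zpow_comm m e γ i

lemma epsPt_apply_eq_one_iff {s : ℕ} {m : ℤ} (hm : m ≠ 0) (γ : ZS s) (i : Fin s) :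
    epsPt m γ i = 1 ↔ m ∣ γ i := by
  have hm' : (m : ℂ) ≠ 0 := by exact_mod_cast hm
  have hp : (2 * Real.pi * Complex.I : ℂ) ≠ 0 := Complex.two_pi_I_ne_zero
  rw [epsPt, Complex.exp_eq_one_iff]
  constructor
  · rintro ⟨n, hn⟩
    refine ⟨-n, ?_⟩
    rw [div_eq_iff hm'] at hn
    have : (2 * Real.pi * Complex.I : ℂ) * γ i = (2 * Real.pi * Complex.I : ℂ) * (m * -n) := by
      linear_combination -hn
    exact_mod_cast mul_left_cancel₀ hp this
  · rintro ⟨n, hn⟩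
    refine ⟨-n, ?_⟩
    rw [hn]
    push_cast
    field_simp

lemma epsPt_apply_zpow_self {s : ℕ} {m : ℤ} (hm : m ≠ 0) (γ : ZS s) (i : Fin s) :
    epsPt m γ i ^ m = 1 := by
  have h := epsPt_zpow_comm m γ (fun _ => m) i
  rw [(epsPt_apply_eq_one_iff hm (fun _ => m) i).2 dvd_rfl, one_zpow] at h
  exact h

lemma zpowV_epsPt_of_dvd {s : ℕ} {m : ℤ} (hm : m ≠ 0) (e : ZS s) {γ δ : ZS s}
    (h : ∀ i, m ∣ γ i - δ i) : zpowV (epsPt m e) γ = zpowV (epsPt m e) δ := by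
  refine Finset.prod_congr rfl fun i _ => ?_
  obtain ⟨n, hn⟩ := h i
  rw [show γ i = δ i + m * n by omega, zpow_add₀ (epsPt_ne_zero m e i), zpow_mul,
    epsPt_apply_zpow_self hm, one_zpow, mul_one]

lemma sum_Ico_zpow_epsPt {s : ℕ} {m : ℤ} (hm : m ≠ 0) (γ : ZS s) (i : Fin s) :
    ∑ x ∈ Finset.Ico 0 |m|, epsPt m γ i ^ x = if m ∣ γ i then ((|m| : ℤ) : ℂ) else 0 := by
  split_ifs with h
  · have h0 : ((|m|.toNat : ℤ) : ℂ) = ((|m| : ℤ) : ℂ) := by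
      rw [Int.toNat_of_nonneg (abs_nonneg m)]
    rw [(epsPt_apply_eq_one_iff hm γ i).2 h]
    simp only [one_zpow, Finset.sum_const, Int.card_Ico, sub_zero, nsmul_eq_mul, mul_one]
    exact_mod_cast h0
  · have h1 : epsPt m γ i ≠ 1 := fun h' => h ((epsPt_apply_eq_one_iff hm γ i).1 h')
    have h2 : epsPt m γ i ^ m.natAbs = 1 := by
      rw [← zpow_natCast]
      rcases Int.natAbs_eq m with h3 | h3
      · rw [← h3]; exact epsPt_apply_zpow_self hm γ i
      · rw [show ((m.natAbs : ℕ) : ℤ) = -m by omega, zpow_neg, epsPt_apply_zpow_self hm γ i,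
          inv_one]
    have h4 : ∑ x ∈ Finset.Ico 0 |m|, epsPt m γ i ^ x =
        ∑ x ∈ Finset.range m.natAbs, epsPt m γ i ^ x := by
      refine (Finset.sum_nbij (fun n : ℕ => (n : ℤ)) ?_ ?_ ?_ ?_).symm
      · intro n hn
        simp only [Finset.mem_range] at hn
        simp only [Finset.mem_Ico, Int.abs_eq_natAbs]
        omega
      · intro x _ y _ hxy
        exact Int.ofNat_inj.1 hxy
      · intro x hx
        simp only [Finset.coe_Ico, Set.mem_Ico, Int.abs_eq_natAbs] at hx
        refine ⟨x.toNat, ?_, ?_⟩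
        · simp only [Finset.coe_range, Set.mem_Iio]; omega
        · simp only; omega
      · intro n _
        rw [zpow_natCast]
    rw [h4, geom_sum_eq h1, h2, sub_self, zero_div]

lemma sum_digitBox_zpowV {s : ℕ} {m : ℤ} (hm : m ≠ 0) (γ : ZS s) :
    ∑ e ∈ digitBox s m, zpowV (epsPt m e) γ =
      if ∀ i, m ∣ γ i then ((|m| : ℤ) : ℂ) ^ s else 0 := by
  calc ∑ e ∈ digitBox s m, zpowV (epsPt m e) γ
      = ∑ e ∈ digitBox s m, ∏ i, epsPt m γ i ^ e i :=
        Finset.sum_congr rfl fun e _ => zpowV_epsPt_comm m e γ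
    _ = ∏ i, ∑ x ∈ Finset.Ico 0 |m|, epsPt m γ i ^ x := (Finset.prod_univ_sum _ _).symm
    _ = ∏ i, if m ∣ γ i then ((|m| : ℤ) : ℂ) else 0 :=
        Finset.prod_congr rfl fun i _ => sum_Ico_zpow_epsPt hm γ i
    _ = _ := by
        rw [Finset.prod_ite_zero]
        simp

lemma forall_dvd_iff_eq_zero {s : ℕ} {m : ℤ} {e : ZS s} (he : e ∈ digitBox s m) :
    (∀ i, m ∣ e i) ↔ e = 0 := by
  refine ⟨fun h => funext fun i => ?_, fun h i => by simp [h]⟩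
  obtain ⟨h0, h1⟩ := mem_digitBox.1 he i
  exact Int.eq_zero_of_abs_lt_dvd ((abs_dvd _ _).2 (h i)) (by rwa [abs_of_nonneg h0])

/-- Sums over all cosets of `mℤ^s` are equal to `c` iff the discrete Fourier transform is
concentrated at the trivial character. -/
lemma cosetSum_eq_const_iff {s : ℕ} {m : ℤ} (hm : m ≠ 0) (A : Finset (ZS s)) (w : ZS s → ℂ)
    (c : ℂ) :
    (∀ α : ZS s, ∑ γ ∈ A with ∀ i, m ∣ α i - γ i, w γ = c) ↔
      ∀ e ∈ digitBox s m, ∑ γ ∈ A, w γ * zpowV (epsPt m e) γ =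
        if e = 0 then ((|m| : ℤ) : ℂ) ^ s * c else 0 := by
  constructor
  · intro h e he
    have key : ∀ γ : ZS s, zpowV (epsPt m e) γ =
        ∑ f ∈ digitBox s m, if ∀ i, m ∣ f i - γ i then zpowV (epsPt m e) f else 0 := by
      intro γ
      rw [Finset.sum_eq_single (fun i => γ i % m)]
      · have hd : ∀ i, m ∣ γ i % m - γ i := fun i =>
          (Int.modEq_iff_dvd.1 (Int.mod_modEq (γ i) m).symm)
        rw [if_pos hd]
        exact (zpowV_epsPt_of_dvd hm e hd).symm
      · intro f hf hne
        refine if_neg fun hd => hne (funext fun i => ?_)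
        obtain ⟨h0, h1⟩ := mem_digitBox.1 hf i
        have h2 : γ i % m = f i % m := Int.modEq_iff_dvd.2 (hd i)
        simp only [h2]
        rw [← Int.emod_abs, Int.emod_eq_of_lt h0 h1]
      · intro hn
        exact (hn (mem_digitBox.2 fun i => ⟨Int.emod_nonneg _ hm, Int.emod_lt_abs _ hm⟩)).elim
    calc ∑ γ ∈ A, w γ * zpowV (epsPt m e) γ
        = ∑ γ ∈ A, ∑ f ∈ digitBox s m,
            zpowV (epsPt m e) f * (if ∀ i, m ∣ f i - γ i then w γ else 0) := by
          refine Finset.sum_congr rfl fun γ _ => ?_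
          conv_lhs => rw [key γ, Finset.mul_sum]
          refine Finset.sum_congr rfl fun f _ => ?_
          split_ifs <;> ring
      _ = ∑ f ∈ digitBox s m, zpowV (epsPt m e) f * c := by
          rw [Finset.sum_comm]
          refine Finset.sum_congr rfl fun f _ => ?_
          rw [← Finset.mul_sum, ← Finset.sum_filter, h f]
      _ = (∑ f ∈ digitBox s m, zpowV (epsPt m f) e) * c := by
          rw [Finset.sum_mul]
          exact Finset.sum_congr rfl fun f _ => by rw [zpowV_epsPt_comm]
      _ = _ := by
          rw [sum_digitBox_zpowV hm]
          simp only [forall_dvd_iff_eq_zero he, ite_mul, zero_mul]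
  · intro h α
    have hM : ((|m| : ℤ) : ℂ) ^ s ≠ 0 := pow_ne_zero _ (by exact_mod_cast abs_ne_zero.2 hm)
    refine mul_left_cancel₀ hM ?_
    calc ((|m| : ℤ) : ℂ) ^ s * ∑ γ ∈ A with ∀ i, m ∣ α i - γ i, w γ
        = ∑ γ ∈ A, w γ * ∑ e ∈ digitBox s m, zpowV (epsPt m e) (γ - α) := by
          rw [Finset.sum_filter, Finset.mul_sum]
          refine Finset.sum_congr rfl fun γ _ => ?_
          rw [sum_digitBox_zpowV hm]
          simp only [Pi.sub_apply, dvd_sub_comm (a := m) (b := γ _)]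
          split_ifs <;> ring
      _ = ∑ e ∈ digitBox s m, zpowV (epsPt m e) (-α) * ∑ γ ∈ A, w γ * zpowV (epsPt m e) γ := by
          simp only [Finset.mul_sum]
          rw [Finset.sum_comm]
          refine Finset.sum_congr rfl fun e _ => Finset.sum_congr rfl fun γ _ => ?_
          rw [sub_eq_add_neg, zpowV_add (epsPt_ne_zero m e)]
          ring
      _ = ∑ e ∈ digitBox s m, if e = 0 then ((|m| : ℤ) : ℂ) ^ s * c else 0 := by
          refine Finset.sum_congr rfl fun e he => ?_
          rw [h e he]
          split_ifs with h0
          · simp [h0, epsPt_zero, zpowV, onesC]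
          · simp
      _ = _ := by
          rw [Finset.sum_ite_eq' , if_pos]
          exact mem_digitBox.2 fun i => ⟨le_rfl, abs_pos.2 hm⟩

lemma symbolD_eq {s : ℕ} {a : ZS s → ℝ} (ha : (Function.support a).Finite) (j : Fin s → ℕ)
    {z : Fin s → ℂ} (hz : ∀ i, z i ≠ 0) :
    symbolD a j z = zpowV z (fun i => -(j i : ℤ)) *
      ∑ γ ∈ ha.toFinset, ((a γ * qpolyR j (fun i => (γ i : ℝ)) : ℝ) : ℂ) * zpowV z γ := by
  unfold symbolD
  rw [finsum_eq_sum_of_support_subset (s := ha.toFinset), Finset.mul_sum]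
  · refine Finset.sum_congr rfl fun γ _ => ?_
    have : (fun i => γ i - (j i : ℤ)) = (fun i => -(j i : ℤ)) + γ := by
      funext i; simp [sub_eq_neg_add]
    rw [this, zpowV_add hz]
    simp only [qpolyC, qpolyR]
    push_cast
    ring
  · intro γ hγ
    simp only [Set.Finite.coe_toFinset, Function.mem_support]
    intro h0
    simp [h0] at hγ

/-- The conditions on the derivatives of the symbol are equivalent to sum rules on cosets. -/
lemma symbolD_conditions_iff {s : ℕ} {m : ℤ} (hm : m ≠ 0) {a : ZS s → ℝ}
    (ha : (Function.support a).Finite) (τ : Fin s → ℝ) (j : Fin s → ℕ) :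
    (symbolD a j onesC = ((|m| : ℤ) : ℂ) ^ s * qpolyC j (fun i => (τ i : ℂ)) ∧
        ∀ e : ZS s, inE m e → e ≠ 0 → symbolD a j (epsPt m e) = 0) ↔
      ∀ α : ZS s, ∑ γ ∈ ha.toFinset with ∀ i, m ∣ α i - γ i,
        a γ * qpolyR j (fun i => (γ i : ℝ)) = qpolyR j τ := by
  have hq : qpolyC j (fun i => (τ i : ℂ)) = (qpolyR j τ : ℂ) := by
    simp only [qpolyC, qpolyR]; push_cast; rfl
  have h := cosetSum_eq_const_iff hm ha.toFinset
    (fun γ => ((a γ * qpolyR j (fun i => (γ i : ℝ)) : ℝ) : ℂ)) (qpolyR j τ : ℂ)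
  have h' : (∀ α : ZS s, ∑ γ ∈ ha.toFinset with ∀ i, m ∣ α i - γ i,
        a γ * qpolyR j (fun i => (γ i : ℝ)) = qpolyR j τ) ↔
      (∀ α : ZS s, ∑ γ ∈ ha.toFinset with ∀ i, m ∣ α i - γ i,
        ((a γ * qpolyR j (fun i => (γ i : ℝ)) : ℝ) : ℂ) = (qpolyR j τ : ℂ)) := by
    refine forall_congr' fun α => ?_
    rw [← Complex.ofReal_sum, Complex.ofReal_inj]
  have h1 : zpowV (onesC : Fin s → ℂ) (fun i => -(j i : ℤ)) = 1 := by simp [zpowV, onesC]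
  rw [h', h, hq]
  constructor
  · rintro ⟨h0, hne⟩ e he
    split_ifs with he0
    · rw [he0, epsPt_zero, ← h0, symbolD_eq ha j (z := onesC) (fun _ => one_ne_zero), h1, one_mul]
    · have := hne e (mem_digitBox.1 he) he0
      rw [symbolD_eq ha j (epsPt_ne_zero m e)] at this
      exact (mul_eq_zero.1 this).resolve_left (zpowV_ne_zero (epsPt_ne_zero m e) _)
  · intro H
    refine ⟨?_, fun e he he0 => ?_⟩
    · have := H 0 (mem_digitBox.2 fun i => ⟨le_rfl, abs_pos.2 hm⟩)
      rw [if_pos rfl, epsPt_zero] at this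
      rw [symbolD_eq ha j (z := onesC) (fun _ => one_ne_zero), h1, one_mul, this]
    · have := H e (mem_digitBox.2 he)
      rw [if_neg he0] at this
      rw [symbolD_eq ha j (epsPt_ne_zero m e), this, mul_zero]

/-! ### The subdivision operator -/

lemma subdOp_eq_sum {s : ℕ} {m : ℤ} (hm : m ≠ 0) {a : ZS s → ℝ}
    (ha : (Function.support a).Finite) (d : ZS s → ℝ) (α : ZS s) :
    subdOp m a d α = ∑ γ ∈ ha.toFinset with ∀ i, m ∣ α i - γ i,
      a γ * d (fun i => (α i - γ i) / m) := by
  have hinj : Function.Injective (fun β : ZS s => α - m • β) := by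
    intro β β' h
    funext i
    have := congrFun h i
    simp only [Pi.sub_apply, Pi.smul_apply, smul_eq_mul, sub_right_inj] at this
    exact mul_left_cancel₀ hm this
  have h1 : subdOp m a d α =
      ∑ᶠ β : ZS s, (fun γ => a γ * d (fun i => (α i - γ i) / m)) (α - m • β) := by
    refine finsum_congr fun β => ?_
    congr 2
    funext i
    simp [hm]
  rw [h1, ← finsum_mem_range hinj (f := fun γ => a γ * d (fun i => (α i - γ i) / m))]
  refine finsum_mem_eq_sum_of_inter_support_eq _ ?_
  ext γ
  simp only [Set.mem_inter_iff, Set.mem_range, Function.mem_support, Finset.coe_filter,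
    Set.Finite.mem_toFinset, Set.mem_ofPred_eq]
  constructor
  · rintro ⟨⟨β, rfl⟩, h⟩
    exact ⟨⟨left_ne_zero_of_mul h, fun i => by simp⟩, h⟩
  · rintro ⟨⟨_, hd⟩, h⟩
    choose β hβ using hd
    refine ⟨⟨β, funext fun i => ?_⟩, h⟩
    simp [← hβ i]

lemma subdOp_sub {s : ℕ} {m : ℤ} (hm : m ≠ 0) {a : ZS s → ℝ}
    (ha : (Function.support a).Finite) (d d' : ZS s → ℝ) :
    subdOp m a (d - d') = subdOp m a d - subdOp m a d' := by
  funext α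
  simp only [Pi.sub_apply, subdOp_eq_sum hm ha, ← Finset.sum_sub_distrib, mul_sub]

lemma iterate_subdOp_sub {s : ℕ} {m : ℤ} (hm : m ≠ 0) {a : ZS s → ℝ}
    (ha : (Function.support a).Finite) (d d' : ZS s → ℝ) (r : ℕ) :
    (subdOp m a)^[r] (d - d') = (subdOp m a)^[r] d - (subdOp m a)^[r] d' := by
  induction r generalizing d d' with
  | zero => rfl
  | succ r ih => simp only [Function.iterate_succ_apply, subdOp_sub hm ha, ih]

lemma subdOp_add_smul {s : ℕ} (m : ℤ) (a d : ZS s → ℝ) (α β : ZS s) :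
    subdOp m a d (α + m • β) = subdOp m a (fun γ => d (γ + β)) α := by
  unfold subdOp
  rw [← finsum_comp_equiv (Equiv.addRight β)]
  refine finsum_congr fun γ => ?_
  simp only [Equiv.coe_addRight, smul_add]
  congr 2
  abel

/-- For polynomial data, `S_a` acts as multiplication of the mask by a polynomial on a coset. -/
lemma subdOp_eval_eq {s : ℕ} {m : ℤ} (hm : m ≠ 0) {a : ZS s → ℝ}
    (ha : (Function.support a).Finite) (π : MvPolynomial (Fin s) ℝ) (α : ZS s) :
    subdOp m a (fun β => MvPolynomial.eval (fun i => (β i : ℝ)) π) α =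
      ∑ γ ∈ ha.toFinset with ∀ i, m ∣ α i - γ i,
        a γ * MvPolynomial.eval (fun i => ((α i : ℝ) - γ i) / m) π := by
  rw [subdOp_eq_sum hm ha]
  refine Finset.sum_congr rfl fun γ hγ => ?_
  congr 3
  funext i
  rw [Int.cast_div ((Finset.mem_filter.1 hγ).2 i) (by exact_mod_cast hm)]
  push_cast
  rfl

/-! ### One-step reproduction -/

/-- `S_a` maps `π|_{ℤ^s}` to `π((· - τ)/m)|_{ℤ^s}` for all `π` of total degree at most `k`. -/
def OneStepReproduces {s : ℕ} (m : ℤ) (a : ZS s → ℝ) (τ : Fin s → ℝ) (k : ℕ) : Prop :=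
  ∀ π : MvPolynomial (Fin s) ℝ, π.totalDegree ≤ k → ∀ α : ZS s,
    subdOp m a (fun β => MvPolynomial.eval (fun i => (β i : ℝ)) π) α =
      MvPolynomial.eval (fun i => ((α i : ℝ) - τ i) / m) π

lemma oneStepReproduces_iff {s : ℕ} {m : ℤ} (hm : m ≠ 0) {a : ZS s → ℝ}
    (ha : (Function.support a).Finite) (τ : Fin s → ℝ) (k : ℕ) :
    OneStepReproduces m a τ k ↔
      ∀ j : Fin s → ℕ, ∑ i, j i ≤ k → ∀ α : ZS s,
        ∑ γ ∈ ha.toFinset with ∀ i, m ∣ α i - γ i,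
          a γ * qpolyR j (fun i => (γ i : ℝ)) = qpolyR j τ := by
  have hm' : (m : ℝ) ≠ 0 := by exact_mod_cast hm
  constructor
  · intro h j hj α
    have h1 := h (affineSubst (-(m : ℝ)) (fun i => α i) (fallingPoly j))
      (((totalDegree_affineSubst_le _ _ _).trans (totalDegree_fallingPoly_le j)).trans hj) α
    rw [subdOp_eval_eq hm ha] at h1
    simp only [eval_affineSubst, eval_fallingPoly] at h1
    have h2 : ∀ x : Fin s → ℝ, (fun i => -(m : ℝ) * (((α i : ℝ) - x i) / m) + α i) = x := by
      intro x
      funext i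
      field_simp
      ring
    simpa only [h2 τ, h2 (fun i => _)] using h1
  · intro h π hπ α
    rw [subdOp_eval_eq hm ha]
    let f : MvPolynomial (Fin s) ℝ →ₗ[ℝ] ℝ :=
      ∑ γ ∈ ha.toFinset with ∀ i, m ∣ α i - γ i,
        a γ • (MvPolynomial.aeval (fun i => (γ i : ℝ))).toLinearMap
    let g : MvPolynomial (Fin s) ℝ →ₗ[ℝ] ℝ := (MvPolynomial.aeval τ).toLinearMap
    have hf : ∀ ρ, f ρ = ∑ γ ∈ ha.toFinset with ∀ i, m ∣ α i - γ i,
        a γ * MvPolynomial.eval (fun i => (γ i : ℝ)) ρ := fun ρ => by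
      simp [f, LinearMap.sum_apply, MvPolynomial.aeval_eq_eval]
    have hg : ∀ ρ, g ρ = MvPolynomial.eval τ ρ := fun ρ => by
      simp [g, MvPolynomial.aeval_eq_eval]
    have h1 := linear_eq_of_fallingPoly f g (n := k)
      (fun j hj => by simpa only [hf, hg, eval_fallingPoly] using h j hj α)
      (π := affineSubst (-(m : ℝ)⁻¹) (fun i => α i / m) π)
      ((totalDegree_affineSubst_le _ _ _).trans hπ)
    rw [hf, hg] at h1
    simp only [eval_affineSubst] at h1
    have h2 : ∀ x : Fin s → ℝ,
        (fun i => -(m : ℝ)⁻¹ * x i + α i / m) = fun i => ((α i : ℝ) - x i) / m := by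
      intro x
      funext i
      field_simp
      ring
    simpa only [h2] using h1

lemma param_succ {s : ℕ} (m : ℤ) (τ : Fin s → ℝ) (r : ℕ) (α : ZS s) (i : Fin s) :
    param m τ (r + 1) α i = (param m τ r α i - τ i) / m := by
  simp only [param, Finset.sum_range_succ', pow_succ, mul_inv, ← Finset.sum_mul]
  simp only [div_eq_mul_inv, pow_zero, mul_inv, inv_one]
  ring

lemma param_zero {s : ℕ} (m : ℤ) (τ : Fin s → ℝ) (α : ZS s) :
    param m τ 0 α = fun i => (α i : ℝ) := by
  funext i; simp [param]

lemma OneStepReproduces.iterate {s : ℕ} {m : ℤ} {a : ZS s → ℝ} {τ : Fin s → ℝ} {k : ℕ}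
    (h : OneStepReproduces m a τ k) (r : ℕ) (π : MvPolynomial (Fin s) ℝ)
    (hπ : π.totalDegree ≤ k) (α : ZS s) :
    (subdOp m a)^[r] (fun β => MvPolynomial.eval (fun i => (β i : ℝ)) π) α =
      MvPolynomial.eval (param m τ r α) π := by
  induction r generalizing π with
  | zero => simp [param_zero]
  | succ r ih =>
    have h2 : ∀ x : Fin s → ℝ,
        (fun i => (m : ℝ)⁻¹ * x i + -τ i / m) = fun i => (x i - τ i) / m := by
      intro x
      funext i
      ring
    have h1 : subdOp m a (fun β => MvPolynomial.eval (fun i => (β i : ℝ)) π) =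
        fun β => MvPolynomial.eval (fun i => (β i : ℝ))
          (affineSubst (m : ℝ)⁻¹ (fun i => -τ i / m) π) := by
      funext β
      rw [h π hπ β, eval_affineSubst, h2 (fun i => (β i : ℝ))]
    rw [Function.iterate_succ_apply, h1, ih _ ((totalDegree_affineSubst_le _ _ _).trans hπ),
      eval_affineSubst, h2]
    congr 2
    funext i
    exact (param_succ m τ r α i).symm

lemma OneStepReproduces.reproduces {s : ℕ} {m : ℤ} {a : ZS s → ℝ} {τ : Fin s → ℝ} {k : ℕ}
    (h : OneStepReproduces m a τ k) : Reproduces m a τ k := fun π hπ =>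
  ⟨fun _ x => MvPolynomial.eval x π, fun _ => MvPolynomial.continuous_eval π,
    fun r α => (h.iterate r π hπ α).symm,
    fun _ hu => Eventually.of_forall fun _ _ => refl_mem_uniformity hu⟩

/-! ### Limits of subdivision schemes -/

lemma ConvergesTo.sub {s : ℕ} {m : ℤ} (hm : m ≠ 0) {a : ZS s → ℝ}
    (ha : (Function.support a).Finite) {τ : Fin s → ℝ} {d d' : ZS s → ℝ}
    {g g' : (Fin s → ℝ) → ℝ} (h : ConvergesTo m a τ d g) (h' : ConvergesTo m a τ d' g') :
    ConvergesTo m a τ (d - d') (g - g') := by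
  obtain ⟨F, hF, hFd, hFg⟩ := h
  obtain ⟨F', hF', hFd', hFg'⟩ := h'
  refine ⟨F - F', fun r => (hF r).sub (hF' r), fun r α => ?_, hFg.sub hFg'⟩
  rw [iterate_subdOp_sub hm ha]
  simp only [Pi.sub_apply, hFd, hFd']

/-- The scheme started from `S_a d` converges to the rescaled limit. -/
lemma ConvergesTo.subdOp {s : ℕ} {m : ℤ} {a : ZS s → ℝ} {τ : Fin s → ℝ} {d : ZS s → ℝ}
    {g : (Fin s → ℝ) → ℝ} (h : ConvergesTo m a τ d g) :
    ConvergesTo m a τ (subdOp m a d) (fun x => g (fun i => (x i - τ i) / m)) := by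
  obtain ⟨F, hF, hFd, hFg⟩ := h
  refine ⟨fun r x => F (r + 1) (fun i => (x i - τ i) / m), fun r => (hF _).comp (by fun_prop),
    fun r α => ?_, ?_⟩
  · rw [← Function.iterate_succ_apply, ← hFd]
    exact congrArg _ (funext fun i => (param_succ m τ r α i).symm)
  · intro u hu
    filter_upwards [(tendsto_add_atTop_nat 1).eventually (hFg u hu)] with r hr x
    exact hr _

lemma bdd_of_periodic {s : ℕ} {m : ℤ} (hm : m ≠ 0) {d : ZS s → ℝ}
    (hd : ∀ i α, d (α + m • Pi.single i 1) = d α) : Bdd d := by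
  let P : AddSubgroup (ZS s) :=
    { carrier := {β | ∀ α, d (α + m • β) = d α}
      add_mem' := fun {x y} hx hy α => by rw [smul_add, ← add_assoc, hy, hx]
      zero_mem' := fun α => by simp
      neg_mem' := fun {x} hx α => by
        rw [← hx (α + m • -x)]
        simp }
  have hP : ∀ β : ZS s, β ∈ P := by
    intro β
    rw [← Finset.univ_sum_single β]
    refine sum_mem fun i _ => ?_
    have h1 : (Pi.single i (β i) : ZS s) = β i • Pi.single i 1 := by
      rw [← Pi.single_smul]; simp
    rw [h1]
    exact P.zsmul_mem (hd i) _
  refine ⟨∑ e ∈ digitBox s m, |d e|, fun α => ?_⟩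
  have h1 : d α = d (fun i => α i % m) := by
    rw [← hP (fun i => α i / m) (fun i => α i % m)]
    congr 1
    funext i
    simp [Int.emod_add_mul_ediv]
  rw [h1]
  exact Finset.single_le_sum (f := fun e => |d e|) (fun _ _ => abs_nonneg _)
    (mem_digitBox.2 fun i => ⟨Int.emod_nonneg _ hm, Int.emod_lt_abs _ hm⟩)

/-- The defect of one-step reproduction for the function `φ`. -/
def stepDefect {s : ℕ} (m : ℤ) (a : ZS s → ℝ) (τ : Fin s → ℝ) (φ : (Fin s → ℝ) → ℝ) :
    ZS s → ℝ :=
  subdOp m a (fun β => φ (fun i => (β i : ℝ))) - fun α => φ (fun i => ((α i : ℝ) - τ i) / m)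

lemma stepDefect_add_smul {s : ℕ} {m : ℤ} (hm : m ≠ 0) (a : ZS s → ℝ) (τ : Fin s → ℝ)
    (φ : (Fin s → ℝ) → ℝ) (α : ZS s) (i : Fin s) :
    stepDefect m a τ φ (α + m • Pi.single i 1) =
      stepDefect m a τ (fun x => φ (x + Pi.single i 1)) α := by
  have hm' : (m : ℝ) ≠ 0 := by exact_mod_cast hm
  simp only [stepDefect, Pi.sub_apply]
  rw [subdOp_add_smul]
  have h1 : ∀ β : ZS s, (fun i' => (((β + Pi.single i 1 : ZS s) i' : ℤ) : ℝ)) =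
      (fun i' => (β i' : ℝ)) + Pi.single i 1 := by
    intro β
    funext y
    by_cases hy : y = i
    · subst hy; simp
    · simp [Pi.single_eq_of_ne hy]
  have h2 : (fun i' => ((((α + m • Pi.single i 1 : ZS s) i' : ℤ) : ℝ) - τ i') / m) =
      (fun i' => ((α i' : ℝ) - τ i') / m) + Pi.single i 1 := by
    funext y
    by_cases hy : y = i
    · subst hy; simp; field_simp; ring
    · simp [Pi.single_eq_of_ne hy]
  simp only [h1, h2]

lemma stepDefect_add_const_mul {s : ℕ} {m : ℤ} (hm : m ≠ 0) {a : ZS s → ℝ}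
    (ha : (Function.support a).Finite) (τ : Fin s → ℝ) (φ ψ : (Fin s → ℝ) → ℝ) (c : ℝ)
    (α : ZS s) :
    stepDefect m a τ (fun x => φ x + c * ψ x) α =
      stepDefect m a τ φ α + c * stepDefect m a τ ψ α := by
  simp only [stepDefect, Pi.sub_apply, subdOp_eq_sum hm ha, mul_sub, Finset.mul_sum, mul_add,
    Finset.sum_add_distrib, mul_left_comm c]
  ring

lemma Reproduces.convergesTo_stepDefect {s : ℕ} {m : ℤ} (hm : m ≠ 0) {a : ZS s → ℝ}
    (ha : (Function.support a).Finite) {τ : Fin s → ℝ} {k : ℕ} (h : Reproduces m a τ k)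
    {π : MvPolynomial (Fin s) ℝ} (hπ : π.totalDegree ≤ k) :
    ConvergesTo m a τ (stepDefect m a τ fun x => MvPolynomial.eval x π) 0 := by
  have h1 := (h π hπ).subdOp
  have h2 := h (affineSubst (m : ℝ)⁻¹ (fun i => -τ i / m) π)
    ((totalDegree_affineSubst_le _ _ _).trans hπ)
  have h3 : ∀ x : Fin s → ℝ,
      (fun i => (m : ℝ)⁻¹ * x i + -τ i / m) = fun i => (x i - τ i) / m := by
    intro x
    funext i
    ring
  simp only [eval_affineSubst, h3 (fun i => _)] at h2
  have h4 := h1.sub hm ha h2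
  rwa [sub_self] at h4

lemma Reproduces.stepDefect_qpolyR {s : ℕ} {m : ℤ} (hm : m ≠ 0) {a : ZS s → ℝ}
    (ha : (Function.support a).Finite) {τ : Fin s → ℝ} (hns : NonSingular m a τ) {k : ℕ}
    (h : Reproduces m a τ k) (n : ℕ) (j : Fin s → ℕ) (hj : ∑ i, j i = n) (hn : n ≤ k)
    (α : ZS s) : stepDefect m a τ (qpolyR j) α = 0 := by
  induction n using Nat.strong_induction_on generalizing j α with
  | _ n ih =>
  have hconv := h.convergesTo_stepDefect hm ha (π := fallingPoly j)
    ((totalDegree_fallingPoly_le j).trans (hj.le.trans hn))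
  simp only [eval_fallingPoly] at hconv
  refine hns.2 _ (bdd_of_periodic hm fun i β => ?_) _ hconv rfl α
  rw [stepDefect_add_smul hm]
  by_cases hji : j i = 0
  · simp only [qpolyR_shift_of_eq_zero j i hji]
  · obtain ⟨j', rfl⟩ : ∃ j' : Fin s → ℕ, j = j' + Pi.single i 1 := by
      refine ⟨j - Pi.single i 1, (tsub_add_cancel_of_le fun y => ?_).symm⟩
      by_cases hy : y = i
      · subst hy; simpa using Nat.one_le_iff_ne_zero.2 hji
      · simp [Pi.single_eq_of_ne hy]
    have hsum : ∑ i, j' i + 1 = n := by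
      rw [← hj]; simp [Finset.sum_add_distrib]
    simp only [qpolyR_shift_add_single]
    rw [stepDefect_add_const_mul hm ha, ih (∑ i, j' i) (by omega) j' rfl (by omega), mul_zero,
      add_zero]

lemma Reproduces.oneStepReproduces {s : ℕ} {m : ℤ} (hm : m ≠ 0) {a : ZS s → ℝ}
    (ha : (Function.support a).Finite) {τ : Fin s → ℝ} (hns : NonSingular m a τ) {k : ℕ}
    (h : Reproduces m a τ k) : OneStepReproduces m a τ k := by
  intro π hπ α
  rw [subdOp_eval_eq hm ha]
  let f : MvPolynomial (Fin s) ℝ →ₗ[ℝ] ℝ :=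
    ∑ γ ∈ ha.toFinset with ∀ i, m ∣ α i - γ i,
      a γ • (MvPolynomial.aeval (fun i => ((α i : ℝ) - γ i) / m)).toLinearMap
  let g : MvPolynomial (Fin s) ℝ →ₗ[ℝ] ℝ :=
    (MvPolynomial.aeval fun i => ((α i : ℝ) - τ i) / m).toLinearMap
  have hf : ∀ ρ, f ρ = ∑ γ ∈ ha.toFinset with ∀ i, m ∣ α i - γ i,
      a γ * MvPolynomial.eval (fun i => ((α i : ℝ) - γ i) / m) ρ := fun ρ => by
    simp [f, LinearMap.sum_apply, MvPolynomial.aeval_eq_eval]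
  have hg : ∀ ρ, g ρ = MvPolynomial.eval (fun i => ((α i : ℝ) - τ i) / m) ρ := fun ρ => by
    simp [g, MvPolynomial.aeval_eq_eval]
  have hfg := linear_eq_of_fallingPoly f g (n := k) (fun j hj => ?_) hπ
  · rwa [hf, hg] at hfg
  · have h1 := h.stepDefect_qpolyR hm ha hns _ j rfl hj α
    rw [hf, hg, ← subdOp_eval_eq hm ha]
    simp only [eval_fallingPoly]
    exact sub_eq_zero.1 h1

/-- **main theorem.** A non-singular subdivision scheme with parametrization
offset `τ` reproduces polynomials of total degree up to `k` if and only if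
`(D^j a)(1,…,1) = |m|^s q_j(τ)` and `(D^j a)(ε) = 0` for all `ε ∈ Ξ'` and all `|j| ≤ k`. -/
theorem stmt8 {s : ℕ} (hs : 1 ≤ s) (m : ℤ) (hm : 2 ≤ |m|)
    (a : ZS s → ℝ) (ha : (Function.support a).Finite) (k : ℕ)
    (τ : Fin s → ℝ) (hns : NonSingular m a τ) :
    Reproduces m a τ k ↔
      ∀ j : Fin s → ℕ, (∑ i, j i) ≤ k →
        symbolD a j onesC = ((|m| : ℤ) : ℂ) ^ s * qpolyC j (fun i => (τ i : ℂ)) ∧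
        ∀ e : ZS s, inE m e → e ≠ 0 → symbolD a j (epsPt m e) = 0 := by
  have hm0 : m ≠ 0 := by
    rintro rfl
    simp at hm
  have hiff : Reproduces m a τ k ↔ OneStepReproduces m a τ k :=
    ⟨fun h => h.oneStepReproduces hm0 ha hns, fun h => h.reproduces⟩
  rw [hiff, oneStepReproduces_iff hm0 ha]
  exact forall₂_congr fun j _ => (symbolD_conditions_iff hm0 ha τ j).symm

end
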